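/- arXiv:2503.04503 — 2 statements merged into one kernel-verified Lean document; each statement's English description precedes it below -/
import Mathlib

section
/- Let V be a finite set, let W : V × V → ℝ be symmetric, nonnegative, with zero diagonal, and assume the graph on V whose edges are the pairs {i,j} with W_{ij} > 0 is connected. For x ∈ V and u : V → ℝ with u_x = 0, let ρ^{W,1}_x(u) = exp(−(1/2) Σ_{{i,j}} W_{ij}(e^{u_i−u_j} + e^{u_j−u_i} − 2)) · √(D(W,u)) · ∏_{i∈V∖{x}} e^{−u_i}/√(2π), with D(W,u) = Σ_T ∏_{{i,j}∈E(T)} W_{ij} e^{u_i+u_j} (sum over all spanning trees T of the complete graph on V). Then for all a, b ∈ V and every bounded measurable function F : ℝ^{V×V} → ℝ, ∫_{ℝ^{V∖{a}}} F((u_i − u_j)_{i,j∈V}) e^{u_b − u_a} ρ^{W,1}_a(u) ∏_{i≠a} du_i = ∫_{ℝ^{V∖{b}}} F((u_i − u_j)_{i,j∈V}) ρ^{W,1}_b(u) ∏_{i≠b} du_i, where in the first integral u_a := 0 and in the second u_b := 0. -/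
/-- The set of (edge sets of) spanning trees of the complete graph on `V`,
i.e. all trees with vertex set `V`, encoded by their edge sets. -/
noncomputable def spanningTrees (V : Type*) [Fintype V] [DecidableEq V] :
    Finset (Finset (Sym2 V)) := by
  classical
  exact Finset.univ.filter fun T =>
    (SimpleGraph.fromEdgeSet (↑T : Set (Sym2 V))).IsTree ∧ ∀ e ∈ T, ¬ e.IsDiag

/-- The spanning-tree generating polynomial `∑_T ∏_{e ∈ T} f e`. -/
noncomputable def treePoly {V : Type*} [Fintype V] [DecidableEq V] (f : Sym2 V → ℝ) : ℝ :=
  ∑ T ∈ spanningTrees V, ∏ e ∈ T, f e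

/-- `D(W,u) = ∑_T ∏_{{i,j} ∈ E(T)} W i j * exp (u i + u j)`, the sum ranging over
all spanning trees of the complete graph on `V`. -/
noncomputable def treeGen {V : Type*} [Fintype V] [DecidableEq V]
    (W : V → V → ℝ) (u : V → ℝ) (hW : ∀ i j, W i j = W j i) : ℝ :=
  treePoly (Sym2.lift ⟨fun i j => W i j * Real.exp (u i + u j),
    fun i j => by simp [hW i j, add_comm]⟩)

/-- Sum over unordered pairs of distinct vertices: for a symmetric summand `f`,
this equals `Σ_{{i,j}} f i j` (half the sum over ordered pairs of distinct vertices). -/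
noncomputable def pairSum {V : Type*} [Fintype V] [DecidableEq V] (f : V → V → ℝ) : ℝ :=
  (1 / 2) * ∑ p ∈ Finset.univ.offDiag, f p.1 p.2

/-- The mixing density `ρ^{W,ϑ}_x(u)` of the Vertex Reinforced Jump Process. -/
noncomputable def mixDensity {V : Type*} [Fintype V] [DecidableEq V]
    (W : V → V → ℝ) (hW : ∀ i j, W i j = W j i) (ϑ : V → ℝ) (x : V) (u : V → ℝ) : ℝ :=
  Real.exp (-(1 / 2) * pairSum (fun i j =>
      W i j * (Real.exp (u i - u j) * ϑ j ^ 2 + Real.exp (u j - u i) * ϑ i ^ 2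
        - 2 * (ϑ i * ϑ j))))
  * Real.sqrt (treeGen W u hW)
  * ∏ i ∈ Finset.univ.filter (fun i => i ≠ x), (ϑ i * Real.exp (-u i) / Real.sqrt (2 * Real.pi))

/-- Extend `u : V∖{a} → ℝ` to `V → ℝ` by setting the value `0` at the pinned vertex `a`. -/
def pin {V : Type*} [DecidableEq V] (a : V) (u : {i : V // i ≠ a} → ℝ) : V → ℝ :=
  fun i => if h : i = a then 0 else u ⟨i, h⟩

open MeasureTheory

theorem card_of_mem_spanningTrees {V : Type*} [Fintype V] [DecidableEq V]
    {T : Finset (Sym2 V)} (hT : T ∈ spanningTrees V) : T.card + 1 = Fintype.card V := by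
  classical
  simp only [spanningTrees, Finset.mem_filter, Finset.mem_univ, true_and] at hT
  obtain ⟨htree, hdiag⟩ := hT
  rw [← htree.card_edgeFinset]
  congr 2
  ext e
  simp only [SimpleGraph.mem_edgeFinset, SimpleGraph.edgeSet_fromEdgeSet, Set.mem_sdiff,
    Finset.mem_coe]
  exact ⟨fun h => ⟨h, hdiag e h⟩, And.left⟩

theorem treeGen_sub_const {V : Type*} [Fintype V] [DecidableEq V]
    (W : V → V → ℝ) (hW : ∀ i j, W i j = W j i) (u : V → ℝ) (c : ℝ) :
    treeGen W (fun i => u i - c) hW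
      = (Real.exp (-c) ^ (Fintype.card V - 1)) ^ 2 * treeGen W u hW := by
  unfold treeGen treePoly
  rw [Finset.mul_sum]
  refine Finset.sum_congr rfl fun T hT => ?_
  rw [← card_of_mem_spanningTrees hT, Nat.add_sub_cancel, ← pow_mul, mul_comm T.card, pow_mul,
    ← Finset.prod_const, ← Finset.prod_mul_distrib]
  refine Finset.prod_congr rfl fun e _ => ?_
  induction e with
  | _ i j =>
    simp only [Sym2.lift_mk]
    rw [sq, ← Real.exp_add, mul_left_comm, ← Real.exp_add]
    congr 2
    ring

/-- Moving the pinned vertex from `a` to `b` and shifting the field by a constant multiplies the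
mixing density by `exp (u b - u a)`. -/
theorem mixDensity_sub_const {V : Type*} [Fintype V] [DecidableEq V]
    (W : V → V → ℝ) (hW : ∀ i j, W i j = W j i) (a b : V) (u : V → ℝ) (c : ℝ) :
    mixDensity W hW (fun _ => 1) b (fun i => u i - c)
      = Real.exp (u b - u a) * mixDensity W hW (fun _ => 1) a u := by
  have hprod (x : V) (v : V → ℝ) :
      ∏ i ∈ Finset.univ.filter (fun i => i ≠ x), (1 * Real.exp (-v i) / Real.sqrt (2 * Real.pi))
        = (∏ i, Real.exp (-v i)) * Real.exp (v x)
          / Real.sqrt (2 * Real.pi) ^ (Fintype.card V - 1) := by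
    rw [Finset.filter_ne', ← Finset.mul_prod_erase Finset.univ _ (Finset.mem_univ x)]
    simp only [one_mul, Finset.prod_div_distrib, Finset.prod_const,
      Finset.card_erase_of_mem (Finset.mem_univ x), Finset.card_univ]
    rw [mul_right_comm, ← Real.exp_add, neg_add_cancel, Real.exp_zero, one_mul]
  have hshift :
      ∏ i, Real.exp (-(u i - c)) = Real.exp c ^ Fintype.card V * ∏ i, Real.exp (-u i) := by
    rw [← Finset.card_univ, ← Finset.prod_const, ← Finset.prod_mul_distrib]
    refine Finset.prod_congr rfl fun i _ => ?_
    rw [← Real.exp_add]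
    congr 1
    ring
  have hcard : Real.exp c ^ Fintype.card V = Real.exp c ^ (Fintype.card V - 1) * Real.exp c := by
    rw [← pow_succ, Nat.sub_add_cancel (Fintype.card_pos_iff.2 ⟨a⟩)]
  unfold mixDensity
  simp only [hprod, hshift, hcard, treeGen_sub_const, sub_sub_sub_cancel_right]
  rw [Real.sqrt_mul (by positivity), Real.sqrt_sq (by positivity), Real.exp_neg, inv_pow,
    Real.exp_sub, Real.exp_sub]
  field_simp

/-- An involutive linear endomorphism of `ι → ℝ` preserves Lebesgue measure. -/
theorem measurePreserving_of_involutive {ι : Type*} [Fintype ι]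
    (L : (ι → ℝ) →ₗ[ℝ] (ι → ℝ)) (hL : Function.Involutive L) :
    MeasurePreserving L volume volume := by
  have hdet : LinearMap.det L * LinearMap.det L = 1 := by
    rw [← map_mul, show L * L = 1 from LinearMap.ext hL, map_one]
  have habs : |LinearMap.det L| = 1 := by
    rcases mul_self_eq_one_iff.1 hdet with h | h <;> simp [h]
  refine ⟨L.continuous_of_finiteDimensional.measurable, ?_⟩
  rw [Real.map_linearMap_volume_pi_eq_smul_volume_pi (left_ne_zero_of_mul_eq_one hdet), abs_inv,
    habs]
  simp

/-- The change of coordinates that subtracts the value at `b`, with the value at `b` replaced by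
its negative. -/
def pivotShift {ι : Type*} [DecidableEq ι] (b : ι) : (ι → ℝ) →ₗ[ℝ] (ι → ℝ) where
  toFun u i := if i = b then -u b else u i - u b
  map_add' u v := by
    ext i
    simp only [Pi.add_apply]
    split_ifs <;> ring
  map_smul' r u := by
    ext i
    simp only [Pi.smul_apply, smul_eq_mul, RingHom.id_apply]
    split_ifs <;> ring

theorem pivotShift_apply {ι : Type*} [DecidableEq ι] (b : ι) (u : ι → ℝ) (i : ι) :
    pivotShift b u i = if i = b then -u b else u i - u b := rfl

theorem pivotShift_involutive {ι : Type*} [DecidableEq ι] (b : ι) :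
    Function.Involutive (pivotShift b) := by
  intro u
  ext i
  by_cases h : i = b <;> simp [pivotShift_apply, h]

/-- Repinning a field from `a` to `b` is a volume-preserving change of variables. -/
theorem integral_pin_sub {V : Type*} [Fintype V] [DecidableEq V] (a b : V) (f : (V → ℝ) → ℝ) :
    ∫ u : {i : V // i ≠ a} → ℝ, f (fun i => pin a u i - pin a u b)
      = ∫ u : {i : V // i ≠ b} → ℝ, f (pin b u) := by
  by_cases hab : a = b
  · subst hab
    have hpin (u : {i : V // i ≠ a} → ℝ) : pin a u a = 0 := dif_pos rfl
    simp only [hpin, sub_zero]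
  let σ : {i : V // i ≠ a} ≃ {i : V // i ≠ b} :=
    (Equiv.swap a b).subtypeEquiv fun i => by
      rw [not_iff_not, Equiv.swap_apply_eq_iff, Equiv.swap_apply_right]
  let p : {i : V // i ≠ a} := ⟨b, Ne.symm hab⟩
  let L := MeasurableEquiv.ofInvolutive (pivotShift p) (pivotShift_involutive p)
    (pivotShift p).continuous_of_finiteDimensional.measurable
  have hL : MeasurePreserving L volume volume :=
    measurePreserving_of_involutive _ (pivotShift_involutive p)
  rw [← (volume_measurePreserving_piCongrLeft (fun _ => ℝ) σ).integral_comp',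
    ← hL.integral_comp' fun v => f (pin b (MeasurableEquiv.piCongrLeft (fun _ => ℝ) σ v))]
  congr with u
  congr with i
  have hR (v : {i : V // i ≠ a} → ℝ) (j : {i : V // i ≠ b}) :
      MeasurableEquiv.piCongrLeft (fun _ => ℝ) σ v j = v (σ.symm j) := by
    obtain ⟨k, rfl⟩ := σ.surjective j
    rw [MeasurableEquiv.coe_piCongrLeft, Equiv.piCongrLeft_apply_apply, Equiv.symm_apply_apply]
  have hpb : pin a u b = u p := by simp [pin, p, Ne.symm hab]
  by_cases hib : i = b
  · simp [pin, hib]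
  have hpin (v : {i : V // i ≠ b} → ℝ) : pin b v i = v ⟨i, hib⟩ := by simp [pin, hib]
  rw [hpin, hR, hpb]
  change _ = pivotShift p u _
  by_cases hia : i = a
  · have hσ : σ.symm ⟨i, hib⟩ = p := by
      rw [Equiv.symm_apply_eq]
      ext
      simp [σ, p, hia]
    rw [hσ]
    simp [pivotShift_apply, pin, hia]
  · have hσ : σ.symm ⟨i, hib⟩ = ⟨i, hia⟩ := by
      rw [Equiv.symm_apply_eq]
      ext
      simp [σ, Equiv.swap_apply_of_ne_of_ne hia hib]
    simp [hσ, pivotShift_apply, pin, hia, hib, p]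

/-- **Integral form of the shift lemma for the mixing measure** (Statement 4).
For any bounded measurable functional `F` of the gradients `(u_i - u_j)`, the
`e^{u_b - u_a}`-tilted integral against the mixing density pinned at `a` equals the
integral against the mixing density pinned at `b`. -/
theorem mixDensity_shift_integral {V : Type*} [Fintype V] [DecidableEq V]
    (W : V → V → ℝ) (hW : ∀ i j, W i j = W j i)
    (hnn : ∀ i j, 0 ≤ W i j) (hdiag : ∀ i, W i i = 0)
    (hconn : (SimpleGraph.fromRel (fun i j => 0 < W i j)).Connected)
    (a b : V) (F : (V × V → ℝ) → ℝ)
    (hFmeas : Measurable F) (hFbdd : ∃ C, ∀ x, |F x| ≤ C) :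
    (∫ u : {i : V // i ≠ a} → ℝ,
        F (fun p => pin a u p.1 - pin a u p.2)
          * (Real.exp (pin a u b - pin a u a) * mixDensity W hW (fun _ => 1) a (pin a u)))
      = ∫ u : {i : V // i ≠ b} → ℝ,
          F (fun p => pin b u p.1 - pin b u p.2)
            * mixDensity W hW (fun _ => 1) b (pin b u) := by
  rw [← integral_pin_sub a b fun v =>
    F (fun p => v p.1 - v p.2) * mixDensity W hW (fun _ => 1) b v]
  simp only [mixDensity_sub_const W hW a b, sub_sub_sub_cancel_right]
end

section
/- Let V be a finite set, let n ≥ 1 be an integer, let W : V × V → ℝ be symmetric with W_{ii} = 0, let u : V → ℝ, let φ : V → ℝⁿ, and let g : V × V → ℝ be symmetric. Suppose z : V → ℝ satisfies z_i² = ‖φ_i‖² + g_{ii} + 1 for every i ∈ V, where ‖·‖ is the Euclidean norm and ⟨·,·⟩ the Euclidean inner product on ℝⁿ. Then Σ_{{i,j}} W_{ij}(⟨φ_i, φ_j⟩ − z_i z_j + g_{ij} + 1) − (1/2) Σ_{{i,j}} W_{ij}(e^{u_j−u_i} z_i² + e^{u_i−u_j} z_j² − 2 z_i z_j) = −(1/2)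 Σ_{{i,j}} W_{ij}(e^{u_j−u_i} + e^{u_i−u_j} − 2) − (1/2) Q, where Q = Σ_{i∈V}(Σ_{k≠i} W_{ik} e^{u_k−u_i})(‖φ_i‖² + g_{ii}) − 2 Σ_{{i,j}} W_{ij}(⟨φ_i, φ_j⟩ + g_{ij}), and all sums Σ_{{i,j}} run over unordered pairs of distinct vertices of V. -/
/-- A sum over ordered pairs of distinct vertices is the pair sum of its symmetrization. -/
theorem sum_sum_ne_eq_pairSum {V : Type*} [Fintype V] [DecidableEq V] (f : V → V → ℝ) :
    ∑ i, ∑ k ∈ Finset.univ.filter (fun k => k ≠ i), f i k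
      = pairSum (fun i j => f i j + f j i) := by
  have hswap : ∑ p ∈ (Finset.univ : Finset V).offDiag, f p.2 p.1
      = ∑ p ∈ (Finset.univ : Finset V).offDiag, f p.1 p.2 :=
    Finset.sum_nbij' Prod.swap Prod.swap (by simp [eq_comm]) (by simp [eq_comm])
      (by simp) (by simp) (by simp)
  have hsum : ∑ p ∈ (Finset.univ : Finset V).offDiag, f p.1 p.2
      = ∑ i, ∑ k ∈ Finset.univ.filter (fun k => k ≠ i), f i k :=
    Finset.sum_finset_product' _ _ _ (by simp [eq_comm])
  rw [pairSum, Finset.sum_add_distrib, hswap, hsum]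
  ring

/-- **Algebraic cancellation for the H^{n|2m} supersymmetric Bayes formula** (Statement 12).
Here `φ i : ℝⁿ` collects the `n` bosonic components of the superspin at vertex `i`,
`g` encodes the symmetrized fermionic pairings, and `z_i² = ‖φ_i‖² + g_{ii} + 1`.
All pair sums run over unordered pairs of distinct vertices. -/
theorem susy_bayes_exponent_general {V : Type*} [Fintype V] [DecidableEq V]
    (n : ℕ) (hn : 1 ≤ n)
    (W : V → V → ℝ) (hW : ∀ i j, W i j = W j i) (hdiag : ∀ i, W i i = 0)
    (u : V → ℝ) (φ : V → Fin n → ℝ) (g : V → V → ℝ) (hg : ∀ i j, g i j = g j i)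
    (z : V → ℝ) (hz : ∀ i, z i ^ 2 = (∑ l, φ i l ^ 2) + g i i + 1) :
    pairSum (fun i j => W i j * ((∑ l, φ i l * φ j l) - z i * z j + g i j + 1))
      - (1 / 2) * pairSum (fun i j =>
          W i j * (Real.exp (u j - u i) * z i ^ 2 + Real.exp (u i - u j) * z j ^ 2
            - 2 * (z i * z j)))
    = -(1 / 2) * pairSum (fun i j =>
          W i j * (Real.exp (u j - u i) + Real.exp (u i - u j) - 2))
      - (1 / 2) * ((∑ i, (∑ k ∈ Finset.univ.filter (fun k => k ≠ i),
              W i k * Real.exp (u k - u i)) * ((∑ l, φ i l ^ 2) + g i i))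
          - 2 * pairSum (fun i j => W i j * ((∑ l, φ i l * φ j l) + g i j))) := by
  simp_rw [Finset.sum_mul]
  rw [sum_sum_ne_eq_pairSum
    (fun i k => W i k * Real.exp (u k - u i) * ((∑ l, φ i l ^ 2) + g i i))]
  simp only [pairSum, Finset.mul_sum (s := Finset.univ.offDiag), ← Finset.sum_sub_distrib]
  refine Finset.sum_congr rfl fun p _ => ?_
  rw [hz, hz, hW p.2 p.1]
  ring
end
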